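/- Assume b ≠ 0, |ρ| < 1, λ > 0 and F({c}) > 0, and assume h(0) = p − a + b·ρ·(μ−r)/σ − λ·∫ y dF(y) > 0. Then there exists a unique κ̂ ∈ (0, 1/c) with h(κ̂) = 0. -/

import Mathlib

open MeasureTheory

/-- For `κ ≤ K < 1 / c`, the integrand `y (1 - κ y) ^ (-η)` is dominated on `[0, c]` by its value
at `κ = K`, `y = c`. -/
lemma mul_one_sub_mul_rpow_neg_le {c η κ K y : ℝ} (hη : 0 < η) (hκ : 0 ≤ κ) (hκK : κ ≤ K)
    (hK : K * c < 1) (hy : y ∈ Set.Icc 0 c) :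
    y * (1 - κ * y) ^ (-η) ≤ c * (1 - K * c) ^ (-η) := by
  have hle : κ * y ≤ K * c := mul_le_mul hκK hy.2 hy.1 (hκ.trans hκK)
  have hrpow : (1 - κ * y) ^ (-η) ≤ (1 - K * c) ^ (-η) :=
    Real.rpow_le_rpow_of_nonpos (by linarith) (by linarith) (by linarith)
  exact mul_le_mul hy.2 hrpow (Real.rpow_nonneg (by linarith) _) (hy.1.trans hy.2)

lemma mul_one_sub_mul_rpow_neg_nonneg {c η κ y : ℝ} (hκ : 0 ≤ κ) (hκc : κ * c < 1)
    (hy : y ∈ Set.Icc 0 c) : 0 ≤ y * (1 - κ * y) ^ (-η) :=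
  mul_nonneg hy.1 (Real.rpow_nonneg (by nlinarith [mul_le_mul_of_nonneg_left hy.2 hκ]) _)

lemma measurable_mul_one_sub_mul_rpow_neg (η κ : ℝ) :
    Measurable fun y : ℝ => y * (1 - κ * y) ^ (-η) := by
  fun_prop

lemma norm_mul_one_sub_mul_rpow_neg_le {c η κ K y : ℝ} (hη : 0 < η) (hκ : 0 ≤ κ) (hκK : κ ≤ K)
    (hc : 0 ≤ c) (hK : K * c < 1) (hy : y ∈ Set.Icc 0 c) :
    ‖y * (1 - κ * y) ^ (-η)‖ ≤ c * (1 - K * c) ^ (-η) := by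
  have hκc : κ * c < 1 := (mul_le_mul_of_nonneg_right hκK hc).trans_lt hK
  rw [Real.norm_of_nonneg (mul_one_sub_mul_rpow_neg_nonneg hκ hκc hy)]
  exact mul_one_sub_mul_rpow_neg_le hη hκ hκK hK hy

section Integral

variable {c η : ℝ} {F : Measure ℝ} [IsFiniteMeasure F]

lemma integrable_mul_one_sub_mul_rpow_neg {κ : ℝ} (hη : 0 < η) (hc : 0 ≤ c) (hκ : 0 ≤ κ)
    (hκc : κ * c < 1) (hF : ∀ᵐ y ∂F, y ∈ Set.Icc 0 c) :
    Integrable (fun y => y * (1 - κ * y) ^ (-η)) F :=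
  Integrable.of_bound (measurable_mul_one_sub_mul_rpow_neg η κ).aestronglyMeasurable _
    (hF.mono fun _ hy => norm_mul_one_sub_mul_rpow_neg_le hη hκ le_rfl hc hκc hy)

lemma integral_mul_one_sub_mul_rpow_neg_mono {κ κ' : ℝ} (hη : 0 < η) (hc : 0 ≤ c) (hκ : 0 ≤ κ)
    (hle : κ ≤ κ') (hκ' : κ' * c < 1) (hF : ∀ᵐ y ∂F, y ∈ Set.Icc 0 c) :
    ∫ y, y * (1 - κ * y) ^ (-η) ∂F ≤ ∫ y, y * (1 - κ' * y) ^ (-η) ∂F := by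
  have hκc : κ * c < 1 := (mul_le_mul_of_nonneg_right hle hc).trans_lt hκ'
  refine integral_mono_ae (integrable_mul_one_sub_mul_rpow_neg hη hc hκ hκc hF)
    (integrable_mul_one_sub_mul_rpow_neg hη hc (hκ.trans hle) hκ' hF) ?_
  filter_upwards [hF] with y hy
  have hy' : κ' * y ≤ κ' * c := mul_le_mul_of_nonneg_left hy.2 (hκ.trans hle)
  have hyy : κ * y ≤ κ' * y := mul_le_mul_of_nonneg_right hle hy.1
  exact mul_le_mul_of_nonneg_left
    (Real.rpow_le_rpow_of_nonpos (by linarith) (by linarith) (by linarith)) hy.1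

lemma continuousOn_integral_mul_one_sub_mul_rpow_neg {K : ℝ} (hη : 0 < η) (hc : 0 ≤ c)
    (hK : K * c < 1) (hF : ∀ᵐ y ∂F, y ∈ Set.Icc 0 c) :
    ContinuousOn (fun κ => ∫ y, y * (1 - κ * y) ^ (-η) ∂F) (Set.Icc 0 K) := by
  refine continuousOn_of_dominated (bound := fun _ => c * (1 - K * c) ^ (-η))
    (fun κ _ => (measurable_mul_one_sub_mul_rpow_neg η κ).aestronglyMeasurable)
    (fun κ hκ => hF.mono fun y hy =>
      norm_mul_one_sub_mul_rpow_neg_le hη hκ.1 hκ.2 hc hK hy)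
    (integrable_const _) ?_
  filter_upwards [hF] with y hy
  refine continuousOn_const.mul (ContinuousOn.rpow_const (by fun_prop) fun κ hκ => Or.inl ?_)
  have : κ * y ≤ K * c := mul_le_mul hκ.2 hy.2 hy.1 (hκ.1.trans hκ.2)
  linarith

/-- An atom at `c` forces the integral to blow up as `κ → 1 / c`. -/
lemma measureReal_singleton_mul_le_integral {κ : ℝ} (hη : 0 < η) (hc : 0 ≤ c) (hκ : 0 ≤ κ)
    (hκc : κ * c < 1) (hF : ∀ᵐ y ∂F, y ∈ Set.Icc 0 c) :
    F.real {c} * (c * (1 - κ * c) ^ (-η)) ≤ ∫ y, y * (1 - κ * y) ^ (-η) ∂F := by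
  have h := setIntegral_le_integral (s := {c})
    (integrable_mul_one_sub_mul_rpow_neg hη hc hκ hκc hF)
    (hF.mono fun y hy => mul_one_sub_mul_rpow_neg_nonneg hκ hκc hy)
  rwa [integral_singleton, smul_eq_mul] at h

end Integral

lemma exists_mem_Ioo_lt_one_sub_mul_rpow_neg {c η : ℝ} (hη : 0 < η) (hc : 0 < c) (M : ℝ) :
    ∃ κ ∈ Set.Ioo 0 (1 / c), M < (1 - κ * c) ^ (-η) := by
  set N := max 2 (M + 1)
  have hN : 2 ≤ N := le_max_left _ _
  have hMN : M + 1 ≤ N := le_max_right _ _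
  have hu0 : 0 < N ^ (-η)⁻¹ := Real.rpow_pos_of_pos (by linarith) _
  have hu1 : N ^ (-η)⁻¹ < 1 :=
    Real.rpow_lt_one_of_one_lt_of_neg (by linarith) (inv_lt_zero.mpr (by linarith))
  refine ⟨(1 - N ^ (-η)⁻¹) / c, ⟨div_pos (by linarith) hc,
    div_lt_div_of_pos_right (by linarith) hc⟩, ?_⟩
  rw [div_mul_cancel₀ _ hc.ne', sub_sub_cancel,
    Real.rpow_inv_rpow (by linarith) (by linarith)]
  linarith

/-- Existence and uniqueness of the optimal liability ratio under CRRA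
preferences: if `b ≠ 0`, `|ρ| < 1`, `λ > 0`, the claim distribution `F` (a
Borel probability measure supported in `[0, c]`) has an atom at `c`, and
`h(0) = p − a + bρ(μ−r)/σ − λ ∫ y dF(y) > 0`, then the function
`h(κ) = p − a + b(ρ(μ−r)/σ − (1−ρ²)ηbκ) − λ ∫ y (1−κy)^(−η) dF(y)` has a
unique zero `κ̂` in `(0, 1/c)`. -/
theorem h_exists_unique_zero
    (p a b m r lam σ ρ c η : ℝ) (hσ : σ ≠ 0) (hlam : 0 < lam)
    (hρ : |ρ| < 1) (hb : b ≠ 0) (hc : 0 < c) (hη : 0 < η)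
    (F : Measure ℝ) [IsProbabilityMeasure F]
    (hsupp : F (Set.Icc 0 c)ᶜ = 0)
    (hatom : 0 < F {c})
    (h0pos : 0 < p - a + b * ρ * (m - r) / σ - lam * ∫ y, y ∂F) :
    ∃! κ : ℝ, κ ∈ Set.Ioo 0 (1 / c) ∧
      p - a + b * (ρ * (m - r) / σ - (1 - ρ ^ 2) * η * b * κ) -
        lam * ∫ y, y * (1 - κ * y) ^ (-η) ∂F = 0 := by
  have hF : ∀ᵐ y ∂F, y ∈ Set.Icc 0 c := hsupp
  set G : ℝ → ℝ := fun κ => ∫ y, y * (1 - κ * y) ^ (-η) ∂F with hG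
  set A := p - a + b * ρ * (m - r) / σ with hA
  set B := (1 - ρ ^ 2) * η * b ^ 2 with hB
  have hBpos : 0 < B := by
    have : ρ ^ 2 < 1 := (sq_lt_one_iff_abs_lt_one ρ).mpr hρ
    exact mul_pos (mul_pos (by linarith) hη) (by positivity)
  have hh : ∀ κ, p - a + b * (ρ * (m - r) / σ - (1 - ρ ^ 2) * η * b * κ) -
      lam * ∫ y, y * (1 - κ * y) ^ (-η) ∂F = A - B * κ - lam * G κ := fun κ => by
    simp only [hA, hB, hG]; ring
  simp only [hh]
  have hG0 : G 0 = ∫ y, y ∂F := by simp [hG]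
  have hlt : ∀ {κ : ℝ}, κ < 1 / c → κ * c < 1 := fun h => (lt_div_iff₀ hc).mp h
  have hanti : StrictAntiOn (fun κ => A - B * κ - lam * G κ) (Set.Ioo 0 (1 / c)) := by
    intro x hx y hy hxy
    have hGle : G x ≤ G y :=
      integral_mul_one_sub_mul_rpow_neg_mono hη hc.le hx.1.le hxy.le (hlt hy.2) hF
    have h₁ := mul_le_mul_of_nonneg_left hGle hlam.le
    have h₂ := mul_lt_mul_of_pos_left hxy hBpos
    simp only
    linarith
  have hα : 0 < F.real {c} := ENNReal.toReal_pos hatom.ne' (measure_ne_top _ _)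
  have hD : 0 < lam * (F.real {c} * c) := by positivity
  obtain ⟨K, hK, hKA⟩ :=
    exists_mem_Ioo_lt_one_sub_mul_rpow_neg hη hc (A / (lam * (F.real {c} * c)))
  have hneg : A - B * K - lam * G K < 0 := by
    have h₁ := mul_le_mul_of_nonneg_left
      (measureReal_singleton_mul_le_integral hη hc.le hK.1.le (hlt hK.2) hF) hlam.le
    have h₂ := (div_lt_iff₀' hD).mp hKA
    have h₃ := mul_pos hBpos hK.1
    simp only [hG]
    linarith
  have hcont : ContinuousOn (fun κ => A - B * κ - lam * G κ) (Set.Icc 0 K) :=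
    ContinuousOn.sub (by fun_prop) (continuousOn_const.mul
      (continuousOn_integral_mul_one_sub_mul_rpow_neg hη hc.le (hlt hK.2) hF))
  obtain ⟨κ, hκ, hκ0⟩ := intermediate_value_Ioo' hK.1.le hcont
    ⟨hneg, by rw [hG0]; linarith⟩
  have hκmem : κ ∈ Set.Ioo 0 (1 / c) := ⟨hκ.1, hκ.2.trans hK.2⟩
  exact ⟨κ, ⟨hκmem, hκ0⟩, fun x hx => hanti.injOn hx.1 hκmem (hx.2.trans hκ0.symm)⟩
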